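/- For every f : ℕ → ℕ and all k, n ∈ ℕ, binom(k,n)_f = ∑ (k! / (k₀!⋯k_n!)) · ∏_{i=0}^{n} f(i)^{k_i}, where the sum ranges over all (n+1)-tuples of nonnegative integers (k₀,…,k_n) satisfying k₀ + k₁ + ⋯ + k_n = k and 0·k₀ + 1·k₁ + ⋯ + n·k_n = n, and k!/(k₀!⋯k_n!) is the multinomial coefficient. -/

import Mathlib

/-- The extended binomial coefficient `binom(k,n)_f`: the sum, over all
`k`-tuples `(π₁,…,π_k)` of nonnegative integers with `π₁ + ⋯ + π_k = n`,
of the products `f(π₁)⋯f(π_k)`. It counts the `f`-weighted integer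
compositions of `n` with exactly `k` parts. -/
def extBinom (f : ℕ → ℕ) (k n : ℕ) : ℕ :=
  ∑ π ∈ Finset.Nat.antidiagonalTuple k n, ∏ i, f (π i)

theorem Polynomial.prod_monomial {R ι : Type*} [CommSemiring R] (s : Finset ι) (d : ι → ℕ)
    (a : ι → R) :
    ∏ i ∈ s, monomial (d i) (a i) = monomial (∑ i ∈ s, d i) (∏ i ∈ s, a i) := by
  classical
  induction s using Finset.induction_on with
  | empty => simp
  | insert i s hi ih =>
    rw [Finset.prod_insert hi, Finset.prod_insert hi, Finset.sum_insert hi, ih,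
      monomial_mul_monomial]

open Polynomial in
theorem extBinom_eq_coeff_pow (f : ℕ → ℕ) (k n : ℕ) :
    extBinom f k n = ((∑ i : Fin (n + 1), monomial (i : ℕ) (f i)) ^ k).coeff n := by
  simp only [Fintype.sum_pow, finsetSum_coeff, prod_monomial, coeff_monomial]
  rw [← Finset.sum_filter, extBinom]
  symm
  refine Finset.sum_bij (fun p _ i => (p i : ℕ)) ?_ ?_ ?_ ?_
  · intro p hp
    simpa [Finset.Nat.mem_antidiagonalTuple] using hp
  · intro p _ q _ h
    funext i
    exact Fin.ext (congrFun h i)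
  · intro π hπ
    rw [Finset.Nat.mem_antidiagonalTuple] at hπ
    have hle (i : Fin k) : π i < n + 1 :=
      Nat.lt_succ_of_le (hπ ▸ Finset.single_le_sum (fun _ _ => Nat.zero_le _) (Finset.mem_univ i))
    exact ⟨fun i => ⟨π i, hle i⟩, by simpa using hπ, rfl⟩
  · intros
    rfl

theorem extBinom_eq_sum_multinomial (f : ℕ → ℕ) (k n : ℕ) :
    extBinom f k n =
      ∑ c ∈ (Finset.Nat.antidiagonalTuple (n + 1) k).filter
          (fun c => ∑ i : Fin (n + 1), (i : ℕ) * c i = n),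
        Nat.multinomial Finset.univ c * ∏ i : Fin (n + 1), f (i : ℕ) ^ c i := by
  rw [extBinom_eq_coeff_pow, Finset.sum_pow_eq_sum_piAntidiag,
    Finset.piAntidiag_univ_fin_eq_antidiagonalTuple, Polynomial.finsetSum_coeff,
    Finset.sum_filter]
  refine Finset.sum_congr rfl fun c _ => ?_
  simp only [Polynomial.monomial_pow, Polynomial.prod_monomial, Polynomial.coeff_natCast_mul,
    Polynomial.coeff_monomial, mul_ite, mul_zero, Nat.cast_id]
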